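/- Let Y be a finite-dimensional real normed space, E a normed space, X a convex subset of Y that is either closed and unbounded, or open, K ⊆ X a closed, bounded and convex set, and let g satisfy hypotheses (g0) and (g1) and be such that ψ_t² ∈ C(X;ℝ,g) for every t ∈ Y; set h(t,u) = g(u) − [g(t) + ⟨g'(t), u − t⟩]. For each n ≥ 1 let L_n : D(L_n) → F(K;E) be a linear operator dominated by a positive linear operator S_n : D(S_n) → F(K;ℝ), with C(X;E,g) ⊆ D(L_n) and C(X;ℝ,g) ⊆ D(S_n). Let K₁ be a closed subset of the interior of K. Then for every F ∈ C(X;E,g) there exists a constant M > 0, depending only on F, K, K₁ and g, such that for all n ≥ 1, all δ > 0 and all t ∈ K₁: ‖L_n(F)(t) − F(t)‖ ≤ ‖L_n(F(t))(t) − F(t)‖ + ω(F,δ)·[S_n(𝟙)(t) + δ⁻²·S_n(ψ_t²)(t)] + M·S_n(h(t,·))(t), where ω(F,·) is the modulus of continuity of F restricted to K and F(t) inside L_n denotes the constant mapping u ↦ F(t). -/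

import Mathlib

open Filter Topology Bornology

/-- Membership in `C(X;E,g)`: continuous on `X` with growth controlled by `g`. -/
def MemCg {Y E : Type*} [NormedAddCommGroup Y] [NormedAddCommGroup E]
    (X : Set Y) (g : Y → ℝ) (F : Y → E) : Prop :=
  ContinuousOn F X ∧ ∃ M > 0, ∀ u ∈ X, ‖F u‖ ≤ M * g u

/-- The modulus of continuity of `F` on `K`:
`ω(F,δ) = sup {‖F u − F t‖ : t, u ∈ K, ‖t − u‖ ≤ δ}`. -/
noncomputable def modulusOfContinuity {Y E : Type*} [NormedAddCommGroup Y]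
    [NormedAddCommGroup E] (K : Set Y) (F : Y → E) (δ : ℝ) : ℝ :=
  sSup {r : ℝ | ∃ t ∈ K, ∃ u ∈ K, ‖t - u‖ ≤ δ ∧ r = ‖F u - F t‖}

/-- The geometric setting of Theorem 4 (finite-dimensional case): `X ⊆ Y` convex and
either closed and unbounded or open, `K ⊆ X` closed, bounded and convex, and `g`
satisfying the hypotheses (g0) and (g1). -/
structure GSettingFin (Y : Type*) [NormedAddCommGroup Y] [NormedSpace ℝ Y] where
  X : Set Y
  K : Set Y
  g : Y → ℝ
  g' : Y → (Y →L[ℝ] ℝ)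
  conv : Convex ℝ X
  closed_unbounded_or_open : (IsClosed X ∧ ¬ IsBounded X) ∨ IsOpen X
  K_sub : K ⊆ X
  K_closed : IsClosed K
  K_bdd : IsBounded K
  K_conv : Convex ℝ K
  -- (g0)
  g_pos : ∀ u ∈ X, 0 < g u
  g_sconv : StrictConvexOn ℝ X g
  g_cont : ContinuousOn g X
  g_diff : ∀ t ∈ K, HasFDerivWithinAt g (g' t) X t
  g'_cont : ContinuousOn g' K
  -- (g1): with B_n := g⁻¹([0,n]) (as a subset of X)
  sublevel_K : ∀ n : ℕ, 1 ≤ n → K ⊆ X ∩ g ⁻¹' Set.Icc (0 : ℝ) (n : ℝ)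
  sublevel_bdd : ∀ n : ℕ, 1 ≤ n → IsBounded (X ∩ g ⁻¹' Set.Icc (0 : ℝ) (n : ℝ))
  sublevel_ne : ∀ n : ℕ, 1 ≤ n → (X \ (X ∩ g ⁻¹' Set.Icc (0 : ℝ) (n : ℝ))).Nonempty
  g_growth : ¬ IsBounded X →
    Tendsto (fun u => g u / ‖u‖) (comap (fun u : Y => ‖u‖) atTop ⊓ 𝓟 X) atTop

variable {Y : Type*} [NormedAddCommGroup Y] [NormedSpace ℝ Y]

/-- `h(t,u) = g(u) − [g(t) + ⟨g'(t), u − t⟩]`. -/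
noncomputable def GSettingFin.h (σ : GSettingFin Y) (t u : Y) : ℝ :=
  σ.g u - (σ.g t + σ.g' t (u - t))

/-- The tangent plane of a convex function on `s` lies below its graph. -/
theorem ConvexOn.add_fderivWithin_sub_le {s : Set Y} {f : Y → ℝ} {f' : Y →L[ℝ] ℝ} {t u : Y}
    (hf : ConvexOn ℝ s f) (ht : t ∈ s) (hu : u ∈ s) (hf' : HasFDerivWithinAt f f' s t) :
    f t + f' (u - t) ≤ f u := by
  have h0 : AffineMap.lineMap t u (0 : ℝ) = t := AffineMap.lineMap_apply_zero t u
  have h1 : AffineMap.lineMap t u (1 : ℝ) = u := AffineMap.lineMap_apply_one t u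
  have hd : HasDerivWithinAt (f ∘ AffineMap.lineMap (k := ℝ) t u) (f' (u - t))
      (AffineMap.lineMap (k := ℝ) t u ⁻¹' s) 0 :=
    hf'.comp_hasDerivWithinAt_of_eq 0 AffineMap.hasDerivWithinAt_lineMap
      (Set.mapsTo_preimage _ _) h0.symm
  have key := (hf.comp_affineMap (AffineMap.lineMap (k := ℝ) t u)).le_slope_of_hasDerivWithinAt
    (x := 0) (y := 1) (by simpa [h0] using ht) (by simpa [h1] using hu) one_pos hd
  simp only [slope_def_field, Function.comp_apply, h0, h1, sub_zero, div_one] at key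
  linarith

namespace GSettingFin

variable (σ : GSettingFin Y)

theorem h_nonneg {t u : Y} (ht : t ∈ σ.K) (hu : u ∈ σ.X) : 0 ≤ σ.h t u :=
  sub_nonneg.2 (σ.g_sconv.convexOn.add_fderivWithin_sub_le (σ.K_sub ht) hu (σ.g_diff t ht))

theorem h_lineMap_le {t u : Y} (ht : t ∈ σ.X) (hu : u ∈ σ.X) {a : ℝ} (ha0 : 0 ≤ a)
    (ha1 : a ≤ 1) : σ.h t (t + a • (u - t)) ≤ a * σ.h t u := by
  have key := σ.g_sconv.convexOn.2 ht hu (sub_nonneg.2 ha1) ha0 (by ring)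
  have e : (1 - a) • t + a • u = t + a • (u - t) := by module
  rw [e] at key
  simp only [smul_eq_mul] at key
  simp only [h, add_sub_cancel_left, map_smul, smul_eq_mul]
  nlinarith

theorem h_pos {t u : Y} (ht : t ∈ σ.K) (hu : u ∈ σ.X) (hne : u ≠ t) : 0 < σ.h t u := by
  have key := σ.g_sconv.2 (σ.K_sub ht) hu hne.symm (one_half_pos (α := ℝ)) one_half_pos
    (add_halves 1)
  have hm := σ.conv (σ.K_sub ht) hu (a := 1 / 2) (b := 1 / 2)
    (by norm_num) (by norm_num) (by norm_num)
  have hn := σ.h_nonneg ht hm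
  have e : (1 / 2 : ℝ) • t + (1 / 2 : ℝ) • u = t + (1 / 2 : ℝ) • (u - t) := by module
  rw [e] at key hn
  simp only [smul_eq_mul] at key
  simp only [h, add_sub_cancel_left, map_smul, smul_eq_mul] at hn ⊢
  linarith

theorem isCompact_K [FiniteDimensional ℝ Y] : IsCompact σ.K :=
  have := FiniteDimensional.proper ℝ Y
  Metric.isCompact_of_isClosed_isBounded σ.K_closed σ.K_bdd

theorem continuousOn_h : ContinuousOn (fun p : Y × Y => σ.h p.1 p.2) (σ.K ×ˢ σ.X) := by
  have hfst : Set.MapsTo Prod.fst (σ.K ×ˢ σ.X) σ.K := fun _ hp => hp.1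
  have hsnd : Set.MapsTo Prod.snd (σ.K ×ˢ σ.X) σ.X := fun _ hp => hp.2
  unfold h
  exact (σ.g_cont.comp continuousOn_snd hsnd).sub
    (((σ.g_cont.mono σ.K_sub).comp continuousOn_fst hfst).add
      ((σ.g'_cont.comp continuousOn_fst hfst).clm_apply (continuousOn_snd.sub continuousOn_fst)))

/-- Away from `K`, the function `h` dominates the distance, uniformly over base points in a closed
subset of the interior of `K`. -/
theorem exists_mul_norm_sub_le_h [FiniteDimensional ℝ Y] {K₁ : Set Y} (hc : IsClosed K₁)
    (hK₁ : K₁ ⊆ interior σ.K) :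
    ∃ r > 0, ∃ c > 0, ∀ t ∈ K₁, ∀ u ∈ σ.X \ σ.K, r ≤ ‖u - t‖ ∧ c * ‖u - t‖ ≤ σ.h t u := by
  have hK₁K : K₁ ⊆ σ.K := hK₁.trans interior_subset
  have hcomp : IsCompact K₁ := σ.isCompact_K.of_isClosed_subset hc hK₁K
  obtain ⟨r, hr, hrK⟩ := hcomp.exists_cthickening_subset_open isOpen_interior hK₁
  have hball : ∀ t ∈ K₁, ∀ w, ‖w - t‖ ≤ r → w ∈ σ.K := fun t ht w hw =>
    interior_subset (hrK (Metric.closedBall_subset_cthickening ht r (by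
      simpa [dist_eq_norm] using hw)))
  have hsph : IsCompact ((K₁ ×ˢ σ.K) ∩ {p : Y × Y | ‖p.2 - p.1‖ = r}) :=
    (hcomp.prod σ.isCompact_K).inter_right
      (isClosed_eq (by fun_prop) continuous_const)
  obtain ⟨c, hc0, hcle⟩ := hsph.exists_forall_le'
    (σ.continuousOn_h.mono fun p hp => ⟨hK₁K hp.1.1, σ.K_sub hp.1.2⟩) (a := 0) (by
      rintro ⟨t, w⟩ ⟨⟨ht, hw⟩, hr'⟩
      refine σ.h_pos (hK₁K ht) (σ.K_sub hw) (sub_ne_zero.1 (norm_pos_iff.1 ?_))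
      exact hr.trans_eq hr'.symm)
  refine ⟨r, hr, c / r, div_pos hc0 hr, fun t ht u hu => ?_⟩
  have hle : r ≤ ‖u - t‖ := by
    by_contra! hlt
    exact hu.2 (hball t ht u hlt.le)
  refine ⟨hle, ?_⟩
  have hpos : 0 < ‖u - t‖ := hr.trans_le hle
  have hnorm : ‖(t + (r / ‖u - t‖) • (u - t)) - t‖ = r := by
    rw [add_sub_cancel_left, norm_smul, Real.norm_of_nonneg (by positivity),
      div_mul_cancel₀ _ hpos.ne']
  have h1 := hcle (t, t + (r / ‖u - t‖) • (u - t)) ⟨⟨ht, hball t ht _ hnorm.le⟩, hnorm⟩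
  have h2 := σ.h_lineMap_le (σ.K_sub (hK₁K ht)) hu.1 (a := r / ‖u - t‖) (by positivity)
    ((div_le_one hpos).2 hle)
  have h3 := h1.trans h2
  rw [div_mul_eq_mul_div, le_div_iff₀ hpos] at h3
  rw [div_mul_eq_mul_div, div_le_iff₀ hr]
  linarith

/-- Off `K`, the increments of a function with growth controlled by `g` are dominated by `h`. -/
theorem exists_norm_sub_le_mul_h [FiniteDimensional ℝ Y] {E : Type*} [NormedAddCommGroup E]
    {K₁ : Set Y} (hc : IsClosed K₁) (hK₁ : K₁ ⊆ interior σ.K) {F : Y → E}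
    (hF : MemCg σ.X σ.g F) :
    ∃ M > 0, ∀ t ∈ K₁, ∀ u ∈ σ.X \ σ.K, ‖F u - F t‖ ≤ M * σ.h t u := by
  obtain ⟨r, hr, c, hc0, hrc⟩ := σ.exists_mul_norm_sub_le_h hc hK₁
  obtain ⟨A, hA, hFA⟩ := hF.2
  obtain ⟨B, hB⟩ := σ.isCompact_K.exists_bound_of_continuousOn σ.g'_cont
  have hd : 0 < c * r := mul_pos hc0 hr
  refine ⟨A * (1 + 2 / (c * r) + |B| / c), by positivity, fun t ht u hu => ?_⟩
  have htK : t ∈ σ.K := interior_subset (hK₁ ht)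
  obtain ⟨hru, hcu⟩ := hrc t ht u hu
  have hgt : σ.g t ≤ 1 := by simpa using (σ.sublevel_K 1 le_rfl htK).2.2
  have hg' : σ.g' t (u - t) ≤ |B| * ‖u - t‖ :=
    (le_abs_self _).trans (((σ.g' t).le_opNorm _).trans
      (mul_le_mul_of_nonneg_right ((hB t htK).trans (le_abs_self B)) (norm_nonneg _)))
  have h1 : 1 ≤ σ.h t u / (c * r) := by
    rw [le_div_iff₀ hd, one_mul]
    exact (mul_le_mul_of_nonneg_left hru hc0.le).trans hcu
  have h2 : ‖u - t‖ ≤ σ.h t u / c := by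
    rw [le_div_iff₀ hc0]; linarith
  have h3 : |B| * ‖u - t‖ ≤ |B| * (σ.h t u / c) := mul_le_mul_of_nonneg_left h2 (abs_nonneg B)
  have hgu : σ.g u + σ.g t ≤ σ.h t u + 2 * (σ.h t u / (c * r)) + |B| * (σ.h t u / c) := by
    have : σ.g u = σ.h t u + (σ.g t + σ.g' t (u - t)) := by simp [h]
    linarith
  calc ‖F u - F t‖ ≤ ‖F u‖ + ‖F t‖ := norm_sub_le _ _
    _ ≤ A * σ.g u + A * σ.g t := add_le_add (hFA u hu.1) (hFA t (σ.K_sub htK))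
    _ = A * (σ.g u + σ.g t) := by ring
    _ ≤ A * (σ.h t u + 2 * (σ.h t u / (c * r)) + |B| * (σ.h t u / c)) := by gcongr
    _ = A * (1 + 2 / (c * r) + |B| / c) * σ.h t u := by ring

end GSettingFin

section ModulusOfContinuity

variable {V E : Type*} [NormedAddCommGroup V] [NormedAddCommGroup E]

theorem modulusOfContinuity_nonneg (K : Set V) (F : V → E) (δ : ℝ) :
    0 ≤ modulusOfContinuity K F δ :=
  Real.sSup_nonneg (by rintro _ ⟨t, -, u, -, -, rfl⟩; exact norm_nonneg _)

theorem norm_sub_le_modulusOfContinuity {K : Set V} (hK : IsCompact K) {F : V → E}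
    (hF : ContinuousOn F K) {δ : ℝ} {t u : V} (ht : t ∈ K) (hu : u ∈ K) (htu : ‖t - u‖ ≤ δ) :
    ‖F u - F t‖ ≤ modulusOfContinuity K F δ := by
  obtain ⟨C, hC⟩ := hK.exists_bound_of_continuousOn hF
  refine le_csSup ⟨C + C, ?_⟩ ⟨t, ht, u, hu, htu, rfl⟩
  rintro _ ⟨x, hx, y, hy, -, rfl⟩
  exact (norm_sub_le _ _).trans (add_le_add (hC y hy) (hC x hx))

theorem norm_sub_le_nat_mul_modulusOfContinuity [NormedSpace ℝ V] {K : Set V}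
    (hK : IsCompact K) (hconv : Convex ℝ K) {F : V → E} (hF : ContinuousOn F K) {δ : ℝ}
    {t : V} (ht : t ∈ K) (N : ℕ) {u : V} (hu : u ∈ K) (htu : ‖u - t‖ ≤ N * δ) :
    ‖F u - F t‖ ≤ N * modulusOfContinuity K F δ := by
  induction N generalizing u with
  | zero =>
    have : u = t := by simpa [sub_eq_zero] using htu
    simp [this]
  | succ N ih =>
    push_cast at htu ⊢
    have hN : (0 : ℝ) < N + 1 := by positivity
    set p : V := t + ((N : ℝ) / (N + 1)) • (u - t) with hp
    have hpK : p ∈ K := hconv.add_smul_sub_mem ht hu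
      ⟨by positivity, (div_le_one hN).2 (by linarith)⟩
    have hpt : ‖p - t‖ ≤ N * δ := by
      rw [hp, add_sub_cancel_left, norm_smul, Real.norm_of_nonneg (by positivity),
        div_mul_eq_mul_div, div_le_iff₀ hN]
      nlinarith [mul_le_mul_of_nonneg_left htu (Nat.cast_nonneg (α := ℝ) N)]
    have hpu : ‖p - u‖ ≤ δ := by
      have e : p - u = (-(1 / (N + 1)) : ℝ) • (u - t) := by
        have : (N : ℝ) / (N + 1) = 1 - 1 / (N + 1) := by field_simp; ring
        rw [hp, this]
        module
      rw [e, norm_smul, norm_neg, Real.norm_of_nonneg (by positivity),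
        div_mul_eq_mul_div, one_mul, div_le_iff₀ hN]
      linarith
    have h1 := norm_sub_le_modulusOfContinuity hK hF hpK hu hpu
    have h2 := ih hpK hpt
    have h3 := norm_sub_le_norm_sub_add_norm_sub (F u) (F p) (F t)
    linarith

theorem norm_sub_le_modulusOfContinuity_mul [NormedSpace ℝ V] {K : Set V}
    (hK : IsCompact K) (hconv : Convex ℝ K) {F : V → E} (hF : ContinuousOn F K) {δ : ℝ}
    (hδ : 0 < δ) {t u : V} (ht : t ∈ K) (hu : u ∈ K) :
    ‖F u - F t‖ ≤ modulusOfContinuity K F δ * (1 + (δ ^ 2)⁻¹ * ‖u - t‖ ^ 2) := by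
  have h1 := norm_sub_le_nat_mul_modulusOfContinuity hK hconv hF ht ⌈‖u - t‖ / δ⌉₊ hu
    ((div_le_iff₀ hδ).1 (Nat.le_ceil _))
  have h2 : (⌈‖u - t‖ / δ⌉₊ : ℝ) ≤ 1 + (‖u - t‖ / δ) ^ 2 := by
    rcases le_total (‖u - t‖ / δ) 1 with hle | hle
    · have : (⌈‖u - t‖ / δ⌉₊ : ℝ) ≤ 1 := by
        exact_mod_cast Nat.ceil_le.2 (by simpa using hle)
      nlinarith [sq_nonneg (‖u - t‖ / δ)]
    · have := Nat.ceil_lt_add_one (show 0 ≤ ‖u - t‖ / δ by positivity)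
      nlinarith
  rw [div_pow, div_eq_inv_mul (‖u - t‖ ^ 2)] at h2
  rw [mul_comm]
  exact h1.trans (mul_le_mul_of_nonneg_right h2 (modulusOfContinuity_nonneg K F δ))

end ModulusOfContinuity

theorem stmt_15
    [FiniteDimensional ℝ Y]
    {E : Type*} [NormedAddCommGroup E] [NormedSpace ℝ E]
    (σ : GSettingFin Y)
    -- ψ_t² ∈ C(X;ℝ,g) for every t ∈ Y
    (hpsi : ∀ t : Y, MemCg σ.X σ.g (fun u => ‖u - t‖ ^ 2))
    (DL : ℕ → Submodule ℝ (Y → E)) (DS : ℕ → Submodule ℝ (Y → ℝ))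
    (L : ∀ n, DL n →ₗ[ℝ] (Y → E)) (S : ∀ n, DS n →ₗ[ℝ] (Y → ℝ))
    -- each S_n is positive
    (hSpos : ∀ n, ∀ f : DS n, (∀ u ∈ σ.X, 0 ≤ f.1 u) → ∀ t ∈ σ.K, 0 ≤ S n f t)
    -- each L_n is dominated by S_n
    (hdom_mem : ∀ n, ∀ F : DL n, (fun u => ‖F.1 u‖) ∈ DS n)
    (hdom : ∀ n, ∀ F : DL n, ∀ t ∈ σ.K,
      ‖L n F t‖ ≤ S n ⟨fun u => ‖F.1 u‖, hdom_mem n F⟩ t)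
    -- C(X;E,g) ⊆ D(L_n) and C(X;ℝ,g) ⊆ D(S_n)
    (hDL : ∀ n, ∀ F : Y → E, MemCg σ.X σ.g F → F ∈ DL n)
    (hDS : ∀ n, ∀ f : Y → ℝ, MemCg σ.X σ.g f → f ∈ DS n)
    -- K₁ a closed subset of the interior of K
    (K₁ : Set Y) (hK₁closed : IsClosed K₁) (hK₁ : K₁ ⊆ interior σ.K) :
    ∀ F : Y → E, ∀ hF : MemCg σ.X σ.g F,
      ∃ M > (0 : ℝ), ∀ n : ℕ, ∀ δ > (0 : ℝ), ∀ t ∈ K₁,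
      ∀ (hc : (fun _ : Y => F t) ∈ DL n) (h1 : (fun _ : Y => (1 : ℝ)) ∈ DS n)
        (hψ : (fun u => ‖u - t‖ ^ 2) ∈ DS n) (hh : σ.h t ∈ DS n),
      ‖L n ⟨F, hDL n F hF⟩ t - F t‖ ≤
        ‖L n ⟨fun _ => F t, hc⟩ t - F t‖ +
          modulusOfContinuity σ.K F δ *
            (S n ⟨fun _ => 1, h1⟩ t + (δ ^ 2)⁻¹ * S n ⟨fun u => ‖u - t‖ ^ 2, hψ⟩ t) +
          M * S n ⟨σ.h t, hh⟩ t := by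
  intro F hF
  obtain ⟨M, hM, hMF⟩ := σ.exists_norm_sub_le_mul_h hK₁closed hK₁ hF
  refine ⟨M, hM, fun n δ hδ t ht hc h1 hψ hh => ?_⟩
  have htK : t ∈ σ.K := interior_subset (hK₁ ht)
  set w := modulusOfContinuity σ.K F δ
  have hw : 0 ≤ w := modulusOfContinuity_nonneg σ.K F δ
  have hpt : ∀ u ∈ σ.X, ‖F u - F t‖ ≤ w * (1 + (δ ^ 2)⁻¹ * ‖u - t‖ ^ 2) + M * σ.h t u := by
    intro u hu
    by_cases huK : u ∈ σ.K
    · have := norm_sub_le_modulusOfContinuity_mul σ.isCompact_K σ.K_conv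
        (hF.1.mono σ.K_sub) hδ htK huK
      have := mul_nonneg hM.le (σ.h_nonneg htK hu)
      linarith
    · have := hMF t ht u ⟨hu, huK⟩
      have : 0 ≤ w * (1 + (δ ^ 2)⁻¹ * ‖u - t‖ ^ 2) := by positivity
      linarith
  let FL : DL n := ⟨F, hDL n F hF⟩
  let cL : DL n := ⟨fun _ => F t, hc⟩
  let oneS : DS n := ⟨fun _ => 1, h1⟩
  let ψS : DS n := ⟨fun u => ‖u - t‖ ^ 2, hψ⟩
  let hS : DS n := ⟨σ.h t, hh⟩
  let dS : DS n := ⟨fun u => ‖(FL - cL).1 u‖, hdom_mem n (FL - cL)⟩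
  have hdiff : ‖L n FL t - L n cL t‖ ≤ S n dS t := by
    simpa only [map_sub, Pi.sub_apply] using hdom n (FL - cL) t htK
  have hpos := hSpos n (w • (oneS + (δ ^ 2)⁻¹ • ψS) + M • hS - dS)
    (fun u hu => sub_nonneg.2 (hpt u hu)) t htK
  simp only [map_sub, map_add, map_smul, Pi.sub_apply, Pi.add_apply, Pi.smul_apply,
    smul_eq_mul] at hpos
  have htri := norm_sub_le_norm_sub_add_norm_sub (L n FL t) (L n cL t) (F t)
  change ‖L n FL t - F t‖ ≤ ‖L n cL t - F t‖ + w * (S n oneS t + (δ ^ 2)⁻¹ * S n ψS t)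
    + M * S n hS t
  linarith
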